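/- arXiv:2510.03580 — 2 statements merged into one kernel-verified Lean document; each statement's English description precedes it below -/
import Mathlib

section
/- For all integers m ≥ 1 and n ≥ 2, the total number of admissible pinnacle sets in Z_m ≀ S_n satisfies #APS(m,n) = (−1)^{⌊(n−1)/2⌋} · Σ_{i=0}^{⌊(n−1)/2⌋} C(n,i) · m^i · (−1)^i = Σ_{k=0}^{⌊(n−1)/2⌋} (m−1)^k · C(n,k) · C(n−k−1, ⌊(n−1)/2⌋−k). -/
open Finset

/-- `Prec p q` means the colored symbol `p = ξ^{p.1}(p.2)` precedes (is smaller than)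
`q = ξ^{q.1}(q.2)`: `a > b`, or (`a = b` and `x > y`). -/
def Prec (p q : ℕ × ℕ) : Prop :=
  q.1 < p.1 ∨ (p.1 = q.1 ∧ q.2 < p.2)

instance : DecidableRel Prec := fun p q => by
  unfold Prec; infer_instance

/-- `w : ℕ → ℕ × ℕ` (read on positions `1,…,n`) is an element of `Z_m ≀ S_n`:
each entry has color `< m` and norm in `{1,…,n}`, and the norms are pairwise distinct. -/
def IsGenPerm (m n : ℕ) (w : ℕ → ℕ × ℕ) : Prop :=
  (∀ i ∈ Finset.Icc 1 n, (w i).1 < m ∧ (w i).2 ∈ Finset.Icc 1 n) ∧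
    Set.InjOn (fun i => (w i).2) (Set.Icc 1 n)

/-- The pinnacle set of the word `w`: values at interior positions `2 ≤ i ≤ n-1`
that strictly dominate both neighbors. -/
def pin (n : ℕ) (w : ℕ → ℕ × ℕ) : Finset (ℕ × ℕ) :=
  ((Finset.Icc 2 (n - 1)).filter
      (fun i => Prec (w (i - 1)) (w i) ∧ Prec (w (i + 1)) (w i))).image w

/-- `P` is an admissible pinnacle set for `Z_m ≀ S_n`. -/
def IsAdmissible (m n : ℕ) (P : Finset (ℕ × ℕ)) : Prop :=
  ∃ w, IsGenPerm m n w ∧ pin n w = P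

/-- `APS m n d` : admissible pinnacle sets for `Z_m ≀ S_n` of cardinality at most `d`. -/
def APS (m n d : ℕ) : Set (Finset (ℕ × ℕ)) :=
  {P | IsAdmissible m n P ∧ P.card ≤ d}

/-- Number of subsets of `{1,…,N}` of size `j` meeting the ballot condition of pinnacle sets. -/
def ballotCount : ℕ → ℕ → ℕ
  | _, 0 => 1
  | 0, _ + 1 => 0
  | N + 1, j + 1 => ballotCount N (j + 1) + if 2 * j + 2 ≤ N then ballotCount N j else 0

theorem ballotCount_zero_right (N : ℕ) : ballotCount N 0 = 1 := by
  cases N <;> rfl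

theorem ballotCount_eq_zero (N j : ℕ) (h : N ≤ 2 * j + 2) : ballotCount N (j + 1) = 0 := by
  induction N with
  | zero => rfl
  | succ N ih =>
    rw [ballotCount, ih (by omega), if_neg (by omega)]

theorem sum_ballotCount (N e : ℕ) (h : 2 * e ≤ N) :
    ∑ j ∈ range (e + 1), ballotCount (N + 1) j = N.choose e := by
  induction N generalizing e with
  | zero =>
    obtain rfl : e = 0 := by omega
    simp [ballotCount_zero_right]
  | succ N ih =>
    cases e with
    | zero => simp [ballotCount_zero_right]
    | succ e =>
      have split : ∑ j ∈ range (e + 1 + 1), ballotCount (N + 1 + 1) j =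
          ∑ j ∈ range (e + 1 + 1), ballotCount (N + 1) j +
            ∑ j ∈ range (e + 1), ballotCount (N + 1) j := by
        rw [sum_range_succ', sum_range_succ' _ (e + 1), ballotCount_zero_right,
          ballotCount_zero_right]
        have : ∀ j ∈ range (e + 1), ballotCount (N + 1 + 1) (j + 1) =
            ballotCount (N + 1) (j + 1) + ballotCount (N + 1) j := by
          intro j hj
          rw [mem_range] at hj
          rw [ballotCount.eq_3, if_pos (by omega)]
        rw [sum_congr rfl this, sum_add_distrib]
        ring
      rw [split, ih e (by omega), Nat.choose_succ_succ, add_comm]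
      congr 1
      by_cases hN : 2 * (e + 1) ≤ N
      · exact ih (e + 1) hN
      · obtain rfl : N = 2 * e + 1 := by omega
        rw [sum_range_succ, ih e (by omega), ballotCount_eq_zero _ _ (by omega), add_zero]
        exact Nat.choose_symm_of_eq_add (by omega)

theorem sum_mul_choose_eq_alternating (a : ℤ) (n d : ℕ) (h : d < n) :
    ∑ k ∈ range (d + 1), a ^ k * (n.choose k : ℤ) * ((n - k - 1).choose (d - k) : ℤ) =
      (-1) ^ d * ∑ i ∈ range (d + 1), (n.choose i : ℤ) * (a + 1) ^ i * (-1) ^ i := by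
  induction d with
  | zero => simp
  | succ d ih =>
    have key : ∑ k ∈ range (d + 1), a ^ k * (n.choose k : ℤ) * ((n - k - 1).choose (d - k) : ℤ) +
        ∑ k ∈ range (d + 1 + 1),
          a ^ k * (n.choose k : ℤ) * ((n - k - 1).choose (d + 1 - k) : ℤ) =
        n.choose (d + 1) * (a + 1) ^ (d + 1) := by
      rw [add_pow, mul_sum, sum_range_succ _ (d + 1), sum_range_succ _ (d + 1), ← add_assoc,
        ← sum_add_distrib]
      congr 1
      · refine sum_congr rfl fun k hk => ?_
        rw [mem_range] at hk
        have h1 : (n - k).choose (d + 1 - k) =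
            (n - k - 1).choose (d - k) + (n - k - 1).choose (d + 1 - k) := by
          obtain ⟨u, hu⟩ : ∃ u, n - k = u + 1 := ⟨n - k - 1, by omega⟩
          obtain ⟨v, hv⟩ : ∃ v, d + 1 - k = v + 1 := ⟨d - k, by omega⟩
          rw [hu, hv, Nat.choose_succ_succ, show d - k = v by omega]
          rfl
        have h2 := Nat.choose_mul (n := n) (k := d + 1) (s := k) (by omega)
        rw [h1] at h2
        zify at h2
        rw [one_pow]
        linear_combination (-a ^ k) * h2
      · simp [mul_comm]
    rw [ih (by omega)] at key
    rw [sum_range_succ (fun i => (n.choose i : ℤ) * (a + 1) ^ i * (-1) ^ i) (d + 1)]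
    have hs : ((-1 : ℤ) ^ (d + 1)) * (-1) ^ (d + 1) = 1 := by
      rw [← mul_pow]; simp
    have hp : (-1 : ℤ) ^ (d + 1) = - (-1) ^ d := by ring
    rw [mul_add]
    linear_combination key - (n.choose (d + 1) : ℤ) * (a + 1) ^ (d + 1) * hs -
      (∑ i ∈ range (d + 1), (n.choose i : ℤ) * (a + 1) ^ i * (-1) ^ i) * hp

/-- Color-`M` symbols with norm at least `x` in `P`. -/
def lastColorFrom (M x : ℕ) (P : Finset (ℕ × ℕ)) : Finset (ℕ × ℕ) :=
  P.filter fun q => q.1 = M ∧ x ≤ q.2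

/-- Sets of symbols with colors at most `M` and distinct norms in `(a, t]` such that each
color-`M` symbol leaves enough unused larger norms to separate the color-`M` symbols of `P`
which do not exceed it in the order `Prec`. -/
structure IsBallotSet (M t a : ℕ) (P : Finset (ℕ × ℕ)) : Prop where
  bounds : ∀ q ∈ P, q.1 ≤ M ∧ a < q.2 ∧ q.2 ≤ t
  injOn : Set.InjOn Prod.snd (P : Set (ℕ × ℕ))
  ballot : ∀ x, (M, x) ∈ P → #(lastColorFrom M x P) + 1 ≤ #(Ioc x t \ P.image Prod.snd)

theorem IsBallotSet.card_sdiff {M t a : ℕ} {P : Finset (ℕ × ℕ)} (h : IsBallotSet M t a P) :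
    #(Ioc a t \ P.image Prod.snd) = t - a - #P := by
  rw [card_sdiff_of_subset, card_image_of_injOn h.injOn, Nat.card_Ioc]
  intro x hx
  obtain ⟨q, hq, rfl⟩ := mem_image.1 hx
  exact mem_Ioc.2 (h.bounds q hq).2

theorem lastColorFrom_eq {M a x : ℕ} {P : Finset (ℕ × ℕ)} (hP : ∀ q ∈ P, a < q.2)
    (hx : x ≤ a + 1) : lastColorFrom M x P = P.filter fun q => q.1 = M :=
  filter_congr fun q hq => ⟨And.left, fun h => ⟨h, by have := hP q hq; omega⟩⟩

theorem isBallotSet_insert {M t a c : ℕ} {P : Finset (ℕ × ℕ)} (hat : a + 1 ≤ t) (hc : c ≤ M)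
    (hP : ∀ q ∈ P, a + 1 < q.2) :
    IsBallotSet M t a (insert (c, a + 1) P) ↔ IsBallotSet M t (a + 1) P ∧
      (c = M → #(P.filter fun q => q.1 = M) + 2 ≤ t - (a + 1) - #P) := by
  have hnot : (c, a + 1) ∉ P := fun h => lt_irrefl _ (hP _ h)
  have hset : ∀ x, a + 1 ≤ x → Ioc x t \ (insert (c, a + 1) P).image Prod.snd =
      Ioc x t \ P.image Prod.snd := by
    intro x hx
    rw [image_insert]
    ext y
    simp only [mem_sdiff, mem_Ioc, mem_insert]
    grind
  have hlow : ∀ x, a + 1 < x → lastColorFrom M x (insert (c, a + 1) P) = lastColorFrom M x P := by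
    intro x hx
    rw [lastColorFrom, filter_insert, if_neg (by simp; omega)]
    rfl
  have htop : c = M → #(lastColorFrom M (a + 1) (insert (c, a + 1) P)) =
      #(P.filter fun q => q.1 = M) + 1 := by
    intro h
    rw [lastColorFrom, filter_insert, if_pos (by simp [h]), card_insert_of_notMem (by simp [hnot])]
    rw [← lastColorFrom, lastColorFrom_eq hP (by omega)]
  constructor
  · intro h
    have hb : IsBallotSet M t (a + 1) P := by
      refine ⟨fun q hq => ⟨(h.bounds q (mem_insert_of_mem hq)).1, hP q hq,
        (h.bounds q (mem_insert_of_mem hq)).2.2⟩, h.injOn.mono (by simp), fun x hx => ?_⟩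
      have := h.ballot x (mem_insert_of_mem hx)
      have hlt := hP _ hx
      rwa [hlow x hlt, hset x (le_of_lt hlt)] at this
    refine ⟨hb, fun hcM => ?_⟩
    have := h.ballot (a + 1) (by simp [hcM])
    rw [htop hcM, hset _ le_rfl, hb.card_sdiff] at this
    omega
  · rintro ⟨hb, htopc⟩
    refine ⟨?_, ?_, ?_⟩
    · intro q hq
      rcases mem_insert.1 hq with rfl | hq
      · exact ⟨hc, by simp, hat⟩
      · have := hb.bounds q hq
        omega
    · rw [coe_insert, Set.injOn_insert (by simpa using hnot)]
      refine ⟨hb.injOn, ?_⟩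
      rintro ⟨q, hq, hq2⟩
      have := hP q hq
      simp at hq2
      omega
    · intro x hx
      rcases mem_insert.1 hx with hx | hx
      · obtain ⟨hMc, rfl⟩ := Prod.mk.inj hx
        have := htopc hMc.symm
        rw [htop hMc.symm, hset _ le_rfl, hb.card_sdiff]
        omega
      · have hlt := hP _ hx
        rw [hlow x hlt, hset x (le_of_lt hlt)]
        exact hb.ballot x hx

open Classical in
/-- Ballot sets with `k` symbols of color below `M` and `j` symbols of color `M`. -/
noncomputable def ballotSets (M t a k j : ℕ) : Finset (Finset (ℕ × ℕ)) :=
  (range (M + 1) ×ˢ Ioc a t).powerset.filter fun P =>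
    IsBallotSet M t a P ∧ #(P.filter fun q => q.1 < M) = k ∧ #(P.filter fun q => q.1 = M) = j

theorem mem_ballotSets {M t a k j : ℕ} {P : Finset (ℕ × ℕ)} :
    P ∈ ballotSets M t a k j ↔ IsBallotSet M t a P ∧
      #(P.filter fun q => q.1 < M) = k ∧ #(P.filter fun q => q.1 = M) = j := by
  simp only [ballotSets, mem_filter, and_iff_right_iff_imp, mem_powerset]
  intro h q hq
  have := h.1.bounds q hq
  simp only [mem_product, mem_range, mem_Ioc]
  omega

theorem IsBallotSet.card_eq {M t a : ℕ} {P : Finset (ℕ × ℕ)} (h : IsBallotSet M t a P) :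
    #P = #(P.filter fun q => q.1 < M) + #(P.filter fun q => q.1 = M) := by
  rw [← card_filter_add_card_filter_not (s := P) fun q => q.1 < M]
  congr 2
  refine filter_congr fun q hq => ?_
  have := (h.bounds q hq).1
  omega

theorem card_ballotSets_filter_not {M t a : ℕ} (k j : ℕ) :
    #((ballotSets M t a k j).filter fun P => ∀ q ∈ P, q.2 ≠ a + 1) =
      #(ballotSets M t (a + 1) k j) := by
  congr 1
  ext P
  simp only [mem_filter, mem_ballotSets]
  constructor
  · rintro ⟨⟨h, hk⟩, hP⟩
    refine ⟨⟨fun q hq => ?_, h.injOn, h.ballot⟩, hk⟩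
    have := h.bounds q hq
    have := hP q hq
    omega
  · rintro ⟨h, hk⟩
    refine ⟨⟨⟨fun q hq => ?_, h.injOn, h.ballot⟩, hk⟩, fun q hq => ?_⟩
    all_goals
      have := h.bounds q hq
      omega

/-- Removing the symbol of smallest norm. -/
theorem IsBallotSet.bounds_erase {M t a c : ℕ} {P : Finset (ℕ × ℕ)} (h : IsBallotSet M t a P)
    (hc : (c, a + 1) ∈ P) : ∀ q ∈ P.erase (c, a + 1), a + 1 < q.2 := by
  intro q hq
  obtain ⟨hne, hq⟩ := mem_erase.1 hq
  have h1 := h.bounds q hq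
  have h2 : q.2 ≠ a + 1 := fun e => hne (h.injOn hq hc e)
  omega

theorem card_ballotSets_filter_lt {M t a c : ℕ} (hat : a + 1 ≤ t) (hc : c < M) (k j : ℕ) :
    #((ballotSets M t a (k + 1) j).filter fun P => (c, a + 1) ∈ P) =
      #(ballotSets M t (a + 1) k j) := by
  refine card_nbij' (fun P => P.erase (c, a + 1)) (fun P => insert (c, a + 1) P) ?_ ?_ ?_ ?_
  · intro P hP
    simp only [coe_filter, Set.mem_ofPred_eq, mem_coe, mem_ballotSets] at hP ⊢
    obtain ⟨⟨h, hk, hj⟩, hcP⟩ := hP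
    have hins := (isBallotSet_insert hat hc.le (h.bounds_erase hcP)).1 (by rwa [insert_erase hcP])
    refine ⟨hins.1, ?_, ?_⟩
    · rw [filter_erase, card_erase_of_mem (by simp [hcP, hc]), hk]; rfl
    · rw [filter_erase, erase_eq_of_notMem (by simp [hc.ne]), hj]
  · intro P hP
    simp only [coe_filter, Set.mem_ofPred_eq, mem_coe, mem_ballotSets] at hP ⊢
    obtain ⟨h, hk, hj⟩ := hP
    have hb : ∀ q ∈ P, a + 1 < q.2 := fun q hq => (h.bounds q hq).2.1
    have hnot : (c, a + 1) ∉ P := fun h => lt_irrefl _ (hb _ h)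
    refine ⟨⟨(isBallotSet_insert hat hc.le hb).2 ⟨h, fun e => absurd e hc.ne⟩, ?_, ?_⟩, by simp⟩
    · rw [filter_insert, if_pos hc, card_insert_of_notMem (by simp [hnot]), hk]
    · rw [filter_insert, if_neg hc.ne, hj]
  · intro P hP
    simp only [coe_filter, Set.mem_ofPred_eq] at hP
    exact insert_erase hP.2
  · intro P hP
    refine erase_insert fun h => ?_
    exact lt_irrefl _ ((mem_ballotSets.1 hP).1.bounds _ h).2.1

theorem card_ballotSets_filter_last {M t a : ℕ} (hat : a + 1 ≤ t) (k j : ℕ) :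
    #((ballotSets M t a k (j + 1)).filter fun P => (M, a + 1) ∈ P) =
      if k + 2 * j + 2 ≤ t - (a + 1) then #(ballotSets M t (a + 1) k j) else 0 := by
  split_ifs with hkj
  · refine card_nbij' (fun P => P.erase (M, a + 1)) (fun P => insert (M, a + 1) P) ?_ ?_ ?_ ?_
    · intro P hP
      simp only [coe_filter, Set.mem_ofPred_eq, mem_coe, mem_ballotSets] at hP ⊢
      obtain ⟨⟨h, hk, hj⟩, hcP⟩ := hP
      have hins := (isBallotSet_insert hat le_rfl (h.bounds_erase hcP)).1
        (by rwa [insert_erase hcP])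
      refine ⟨hins.1, ?_, ?_⟩
      · rw [filter_erase, erase_eq_of_notMem (by simp), hk]
      · rw [filter_erase, card_erase_of_mem (by simp [hcP]), hj]; rfl
    · intro P hP
      simp only [coe_filter, Set.mem_ofPred_eq, mem_coe, mem_ballotSets] at hP ⊢
      obtain ⟨h, hk, hj⟩ := hP
      have hb : ∀ q ∈ P, a + 1 < q.2 := fun q hq => (h.bounds q hq).2.1
      have hnot : (M, a + 1) ∉ P := fun h => lt_irrefl _ (hb _ h)
      have hcard := h.card_eq
      refine ⟨⟨(isBallotSet_insert hat le_rfl hb).2 ⟨h, fun _ => by omega⟩, ?_, ?_⟩, by simp⟩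
      · rw [filter_insert, if_neg (lt_irrefl _), hk]
      · rw [filter_insert, if_pos rfl, card_insert_of_notMem (by simp [hnot]), hj]
    · intro P hP
      simp only [coe_filter, Set.mem_ofPred_eq] at hP
      exact insert_erase hP.2
    · intro P hP
      refine erase_insert fun h => ?_
      exact lt_irrefl _ ((mem_ballotSets.1 hP).1.bounds _ h).2.1
  · rw [card_eq_zero, filter_eq_empty_iff]
    intro P hP hcP
    obtain ⟨h, hk, hj⟩ := mem_ballotSets.1 hP
    have hins := (isBallotSet_insert hat le_rfl (h.bounds_erase hcP)).1
      (by rwa [insert_erase hcP])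
    have hlast := hins.2 rfl
    rw [filter_erase, card_erase_of_mem (by simp [hcP]), card_erase_of_mem hcP, hj] at hlast
    have := h.card_eq
    omega

theorem card_ballotSets_filter_lt_zero {M t a c : ℕ} (hc : c < M) (j : ℕ) :
    #((ballotSets M t a 0 j).filter fun P => (c, a + 1) ∈ P) = 0 := by
  rw [card_eq_zero, filter_eq_empty_iff]
  intro P hP hcP
  have h := (mem_ballotSets.1 hP).2.1
  rw [card_eq_zero, filter_eq_empty_iff] at h
  exact h hcP hc

theorem card_ballotSets_filter_last_zero {M t a : ℕ} (k : ℕ) :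
    #((ballotSets M t a k 0).filter fun P => (M, a + 1) ∈ P) = 0 := by
  rw [card_eq_zero, filter_eq_empty_iff]
  intro P hP hcP
  have h := (mem_ballotSets.1 hP).2.2
  rw [card_eq_zero, filter_eq_empty_iff] at h
  exact h hcP rfl

theorem card_ballotSets_split {M t a : ℕ} (k j : ℕ) :
    #(ballotSets M t a k j) = #(ballotSets M t (a + 1) k j) +
      (∑ c ∈ range M, #((ballotSets M t a k j).filter fun P => (c, a + 1) ∈ P)) +
      #((ballotSets M t a k j).filter fun P => (M, a + 1) ∈ P) := by
  rw [← card_ballotSets_filter_not, add_assoc,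
    ← sum_range_succ fun c => #((ballotSets M t a k j).filter fun P => (c, a + 1) ∈ P),
    ← card_biUnion]
  · rw [← card_filter_add_card_filter_not (s := ballotSets M t a k j)
      fun P => ∀ q ∈ P, q.2 ≠ a + 1]
    congr 2
    ext P
    simp only [mem_filter, mem_biUnion, mem_range]
    constructor
    · rintro ⟨hP, hex⟩
      push Not at hex
      obtain ⟨q, hq, hq2⟩ := hex
      have := ((mem_ballotSets.1 hP).1.bounds q hq).1
      exact ⟨q.1, by omega, hP, by rwa [← hq2]⟩
    · rintro ⟨c, -, hP, hcP⟩
      exact ⟨hP, fun h => h _ hcP rfl⟩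
  · intro c _ c' _ hcc
    rw [Function.onFun, disjoint_left]
    intro P hP hP'
    rw [mem_filter] at hP hP'
    exact hcc (congrArg Prod.fst ((mem_ballotSets.1 hP.1).1.injOn hP.2 hP'.2 rfl))

theorem card_ballotSets_self {M t : ℕ} (k j : ℕ) :
    #(ballotSets M t t k j) = if k = 0 ∧ j = 0 then 1 else 0 := by
  have hempty : ∀ P, IsBallotSet M t t P ↔ P = ∅ := by
    intro P
    refine ⟨fun h => eq_empty_of_forall_notMem fun q hq => ?_, ?_⟩
    · have := h.bounds q hq
      omega
    · rintro rfl
      exact ⟨by simp, by simp, by simp⟩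
  split_ifs with h
  · rw [card_eq_one]
    refine ⟨∅, ?_⟩
    ext P
    rw [mem_ballotSets, hempty, mem_singleton]
    refine ⟨And.left, ?_⟩
    rintro rfl
    simp [h]
  · rw [card_eq_zero]
    refine eq_empty_of_forall_notMem fun P hP => h ?_
    obtain ⟨hP, hk, hj⟩ := mem_ballotSets.1 hP
    obtain rfl := (hempty P).1 hP
    exact ⟨by simpa using hk.symm, by simpa using hj.symm⟩

theorem card_ballotSets (M N a k j : ℕ) :
    #(ballotSets M (a + N) a k j) = M ^ k * N.choose k * ballotCount (N - k) j := by
  induction N generalizing a k j with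
  | zero =>
    rw [add_zero, card_ballotSets_self]
    cases k <;> cases j <;> simp [ballotCount]
  | succ N ih =>
    rw [card_ballotSets_split, show a + (N + 1) = a + 1 + N by ring, ih]
    have hrec : ∀ k j, N.choose k * ballotCount (N + 1 - k) (j + 1) =
        N.choose k * (ballotCount (N - k) (j + 1) +
          if k + 2 * j + 2 ≤ a + 1 + N - (a + 1) then ballotCount (N - k) j else 0) := by
      intro k j
      by_cases hk : k ≤ N
      · rw [show N + 1 - k = (N - k) + 1 by omega, ballotCount]
        congr 3
        rw [eq_iff_iff]
        omega
      · rw [Nat.choose_eq_zero_of_lt (by omega), zero_mul, zero_mul]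
    have hlast : ∀ k, #((ballotSets M (a + 1 + N) a k j).filter fun P => (M, a + 1) ∈ P) +
        M ^ k * N.choose k * ballotCount (N - k) j =
        M ^ k * N.choose k * ballotCount (N + 1 - k) j := by
      intro k
      cases j with
      | zero =>
        rw [card_ballotSets_filter_last_zero, ballotCount_zero_right, ballotCount_zero_right,
          zero_add]
      | succ j =>
        rw [card_ballotSets_filter_last (by omega), ih, mul_assoc _ _ (ballotCount (N + 1 - k) _),
          hrec]
        split_ifs <;> ring
    have hl := hlast k
    cases k with
    | zero =>
      rw [sum_eq_zero fun c hc => card_ballotSets_filter_lt_zero (mem_range.1 hc) j]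
      simp only [Nat.choose_zero_right] at hl ⊢
      omega
    | succ k =>
      rw [sum_congr rfl fun c hc =>
        card_ballotSets_filter_lt (by omega) (mem_range.1 hc) k j, sum_const, card_range, ih,
        smul_eq_mul, Nat.choose_succ_succ]
      rw [Nat.add_sub_add_right] at hl ⊢
      linear_combination hl

theorem exists_anti_enumeration {α : Type*} [LinearOrder α] [Inhabited α] (S : Finset α) :
    ∃ f : ℕ → α, (∀ i, 1 ≤ i → i ≤ #S → f i ∈ S) ∧
      (∀ i j, 1 ≤ i → i < j → j ≤ #S → f j < f i) ∧
      (∀ s ∈ S, ∃ i, 1 ≤ i ∧ i ≤ #S ∧ f i = s) ∧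
      ∀ i, 1 ≤ i → i ≤ #S → #(S.filter fun s => f i ≤ s) = i := by
  let e := S.orderEmbOfFin rfl
  let f : ℕ → α := fun i => if h : 1 ≤ i ∧ i ≤ #S then e ⟨#S - i, by omega⟩ else default
  have hf : ∀ i (h1 : 1 ≤ i) (h2 : i ≤ #S), f i = e ⟨#S - i, by omega⟩ :=
    fun i h1 h2 => dif_pos ⟨h1, h2⟩
  have hmem : ∀ i, 1 ≤ i → i ≤ #S → f i ∈ S := by
    intro i h1 h2
    rw [hf i h1 h2]
    exact S.orderEmbOfFin_mem rfl _
  have hanti : ∀ i j, 1 ≤ i → i < j → j ≤ #S → f j < f i := by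
    intro i j h1 hij h2
    rw [hf i h1 (by omega), hf j (by omega) h2]
    exact e.lt_iff_lt.2 (by rw [Fin.mk_lt_mk]; omega)
  have hsurj : ∀ s ∈ S, ∃ i, 1 ≤ i ∧ i ≤ #S ∧ f i = s := by
    intro s hs
    have : s ∈ Set.range e := by
      rw [S.range_orderEmbOfFin rfl]
      exact hs
    obtain ⟨i, rfl⟩ := this
    have hi := i.2
    refine ⟨#S - i, by omega, by omega, ?_⟩
    rw [hf _ (by omega) (by omega)]
    congr 1
    ext
    simp only
    omega
  refine ⟨f, hmem, hanti, hsurj, fun i h1 h2 => ?_⟩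
  have himage : (S.filter fun s => f i ≤ s) = (Icc 1 i).image f := by
    ext s
    simp only [mem_filter, mem_image, mem_Icc]
    constructor
    · rintro ⟨hs, hle⟩
      obtain ⟨j, hj1, hj2, rfl⟩ := hsurj s hs
      refine ⟨j, ⟨hj1, ?_⟩, rfl⟩
      by_contra hlt
      exact absurd (hanti i j h1 (by omega) hj2) (not_lt.2 hle)
    · rintro ⟨j, ⟨hj1, hj2⟩, rfl⟩
      refine ⟨hmem j hj1 (by omega), ?_⟩
      rcases hj2.lt_or_eq with h | rfl
      · exact (hanti j i hj1 h h2).le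
      · exact le_rfl
  rw [himage, card_image_of_injOn, Nat.card_Icc]
  · omega
  · intro j hj j' hj' hjj
    simp only [coe_Icc, Set.mem_Icc] at hj hj'
    rcases lt_trichotomy j j' with h | h | h
    · exact absurd hjj (hanti j j' hj.1 h (by omega)).ne'
    · exact h
    · exact absurd hjj (hanti j' j hj'.1 h (by omega)).ne

theorem IsAdmissible.isBallotSet {M n : ℕ} {P : Finset (ℕ × ℕ)}
    (h : IsAdmissible (M + 1) n P) : IsBallotSet M n 0 P := by
  obtain ⟨w, ⟨hw, hinj⟩, rfl⟩ := h
  have hpin : ∀ q ∈ pin n w, ∃ i, 2 ≤ i ∧ i ≤ n - 1 ∧ Prec (w (i - 1)) (w i) ∧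
      Prec (w (i + 1)) (w i) ∧ w i = q := by
    intro q hq
    simp only [pin, mem_image, mem_filter, mem_Icc] at hq
    obtain ⟨i, ⟨⟨h1, h2⟩, h3, h4⟩, rfl⟩ := hq
    exact ⟨i, h1, h2, h3, h4, rfl⟩
  refine ⟨fun q hq => ?_, ?_, fun x hx => ?_⟩
  · obtain ⟨i, h1, h2, -, -, rfl⟩ := hpin q hq
    have := hw i (mem_Icc.2 ⟨by omega, by omega⟩)
    rw [mem_Icc] at this
    omega
  · intro q hq q' hq' hqq
    obtain ⟨i, h1, h2, -, -, rfl⟩ := hpin q hq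
    obtain ⟨j, h3, h4, -, -, rfl⟩ := hpin q' hq'
    rw [hinj (Set.mem_Icc.2 ⟨by omega, by omega⟩) (Set.mem_Icc.2 ⟨by omega, by omega⟩) hqq]
  · let S := (Icc 2 (n - 1)).filter fun i =>
      (Prec (w (i - 1)) (w i) ∧ Prec (w (i + 1)) (w i)) ∧ (w i).1 = M ∧ x ≤ (w i).2
    have hS : ∀ i, i ∈ S ↔ (2 ≤ i ∧ i ≤ n - 1) ∧
        (Prec (w (i - 1)) (w i) ∧ Prec (w (i + 1)) (w i)) ∧ (w i).1 = M ∧ x ≤ (w i).2 := by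
      intro i
      simp only [S, mem_filter, mem_Icc]
    have hle : #(lastColorFrom M x (pin n w)) ≤ #S := by
      refine (card_le_card fun q hq => ?_).trans (card_image_le (s := S) (f := w))
      obtain ⟨hq, hc, hxq⟩ := mem_filter.1 hq
      obtain ⟨i, h1, h2, h3, h4, rfl⟩ := hpin q hq
      exact mem_image_of_mem w ((hS i).2 ⟨⟨h1, h2⟩, ⟨h3, h4⟩, hc, hxq⟩)
    have hne : S.Nonempty := by
      obtain ⟨i, h1, h2, h3, h4, h5⟩ := hpin _ hx
      exact ⟨i, (hS i).2 ⟨⟨h1, h2⟩, ⟨h3, h4⟩, by rw [h5], by rw [h5]⟩⟩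
    let s := S.min' hne
    have hsS : s ∈ S := S.min'_mem hne
    have hs := (hS s).1 hsS
    let V := insert (s - 1) (S.image (· + 1))
    have hVcard : #V = #S + 1 := by
      rw [card_insert_of_notMem, card_image_of_injective _ (add_left_injective 1)]
      intro hmem
      obtain ⟨i, hi, hi'⟩ := mem_image.1 hmem
      have : s ≤ i := S.min'_le i hi
      omega
    have hV : ∀ v ∈ V, 1 ≤ v ∧ v ≤ n ∧ (∃ i ∈ S, Prec (w v) (w i)) ∧
        ¬ (Prec (w (v - 1)) (w v) ∧ Prec (w (v + 1)) (w v)) := by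
      intro v hv
      rcases mem_insert.1 hv with rfl | hv
      · refine ⟨by omega, by omega, ⟨s, hsS, hs.2.1.1⟩, fun hp => ?_⟩
        have h1 := hs.2.1.1
        have h2 := hp.2
        rw [show s - 1 + 1 = s by omega] at h2
        unfold Prec at h1 h2
        omega
      · obtain ⟨i, hi, rfl⟩ := mem_image.1 hv
        have hi' := (hS i).1 hi
        refine ⟨by omega, by omega, ⟨i, hi, hi'.2.1.2⟩, fun hp => ?_⟩
        have h1 := hi'.2.1.2
        have h2 := hp.1
        rw [Nat.add_sub_cancel] at h2
        unfold Prec at h1 h2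
        omega
    have himage : #(V.image fun v => (w v).2) = #V := by
      refine card_image_of_injOn (hinj.mono fun v hv => ?_)
      exact Set.mem_Icc.2 ⟨(hV v hv).1, (hV v hv).2.1⟩
    have hsub : (V.image fun v => (w v).2) ⊆ Ioc x n \ (pin n w).image Prod.snd := by
      intro y hy
      obtain ⟨v, hv, rfl⟩ := mem_image.1 hy
      obtain ⟨hv1, hv2, ⟨i, hi, hprec⟩, hnot⟩ := hV v hv
      have hwv := hw v (mem_Icc.2 ⟨hv1, hv2⟩)
      rw [mem_Icc] at hwv
      have hi' := (hS i).1 hi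
      rw [mem_sdiff, mem_Ioc]
      refine ⟨?_, fun hmem => ?_⟩
      · unfold Prec at hprec
        omega
      · obtain ⟨q, hq, hqv⟩ := mem_image.1 hmem
        obtain ⟨j, h1, h2, h3, h4, rfl⟩ := hpin q hq
        have : j = v := hinj (Set.mem_Icc.2 ⟨by omega, by omega⟩) (Set.mem_Icc.2 ⟨hv1, hv2⟩) hqv
        subst this
        exact hnot ⟨h3, h4⟩
    have := card_le_card hsub
    omega

theorem IsBallotSet.isAdmissible {M n : ℕ} {P : Finset (ℕ × ℕ)} (h : IsBallotSet M n 0 P)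
    (hcard : 2 * #P + 1 ≤ n) : IsAdmissible (M + 1) n P := by
  let C := Ioc 0 n \ P.image Prod.snd
  have hC : #C = n - #P := by simpa using h.card_sdiff
  have hCmem : ∀ y ∈ C, 0 < y ∧ y ≤ n ∧ ∀ q ∈ P, q.2 ≠ y := by
    intro y hy
    simp only [C, mem_sdiff, mem_Ioc, mem_image, not_exists, not_and] at hy
    exact ⟨hy.1.1, hy.1.2, hy.2⟩
  obtain ⟨v, hvmem, hvanti, -, hvcard⟩ := exists_anti_enumeration C
  let PL : Finset (ℕ ×ₗ ℕ) := P.map toLex.toEmbedding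
  have hPL : #PL = #P := card_map _
  obtain ⟨p', hpmem', hpanti', hpsurj', hpcard'⟩ := exists_anti_enumeration PL
  rw [hPL] at hpmem' hpanti' hpsurj' hpcard'
  let p : ℕ → ℕ × ℕ := fun i => ofLex (p' i)
  have hpmem : ∀ i, 1 ≤ i → i ≤ #P → p i ∈ P := by
    intro i h1 h2
    obtain ⟨q, hq, hqi⟩ := mem_map.1 (hpmem' i h1 h2)
    simp only [p, ← hqi]
    exact hq
  have hpsurj : ∀ q ∈ P, ∃ i, 1 ≤ i ∧ i ≤ #P ∧ p i = q := by
    intro q hq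
    obtain ⟨i, h1, h2, h3⟩ := hpsurj' (toLex q) (mem_map_of_mem _ hq)
    exact ⟨i, h1, h2, by simp only [p, h3]; rfl⟩
  have hpinj : ∀ i j, 1 ≤ i → i ≤ #P → 1 ≤ j → j ≤ #P → p i = p j → i = j := by
    intro i j h1 h2 h3 h4 hij
    have hij' : p' i = p' j := ofLex.injective hij
    rcases lt_trichotomy i j with hlt | heq | hlt
    · exact absurd hij' (hpanti' i j h1 hlt h4).ne'
    · exact heq
    · exact absurd hij' (hpanti' j i h3 hlt h2).ne
  have hvinj : ∀ i j, 1 ≤ i → i ≤ #C → 1 ≤ j → j ≤ #C → v i = v j → i = j := by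
    intro i j h1 h2 h3 h4 hij
    rcases lt_trichotomy i j with hlt | heq | hlt
    · exact absurd hij (hvanti i j h1 hlt h4).ne'
    · exact heq
    · exact absurd hij (hvanti j i h3 hlt h2).ne
  have hbelow : ∀ i, 1 ≤ i → i ≤ #P → Prec (M, v (i + 1)) (p i) := by
    intro i h1 h2
    have hb := h.bounds _ (hpmem i h1 h2)
    rcases hb.1.lt_or_eq with hlt | heq
    · exact Or.inl hlt
    refine Or.inr ⟨heq.symm, ?_⟩
    by_contra hle
    simp only [not_lt] at hle
    have hpi : (M, (p i).2) ∈ P := by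
      rw [← heq]
      exact hpmem i h1 h2
    have hbal := h.ballot _ hpi
    have hlow : #(lastColorFrom M (p i).2 P) = i := by
      refine Eq.trans ?_ (hpcard' i h1 h2)
      rw [← card_map toLex.toEmbedding]
      congr 1
      ext q
      simp only [lastColorFrom, PL, mem_map, mem_filter]
      constructor
      · rintro ⟨r, ⟨hr, hr1, hr2⟩, rfl⟩
        refine ⟨⟨r, hr, rfl⟩, Prod.Lex.le_iff.2 (Or.inr ⟨?_, ?_⟩)⟩
        · exact heq.trans hr1.symm
        · exact hr2
      · rintro ⟨⟨r, hr, rfl⟩, hle⟩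
        refine ⟨r, ⟨hr, ?_⟩, rfl⟩
        have hrb := (h.bounds r hr).1
        rcases Prod.Lex.le_iff.1 hle with hlt | ⟨he, hs⟩
        · exact absurd (lt_of_eq_of_lt heq.symm hlt) (not_lt.2 hrb)
        · exact ⟨(heq.symm.trans he).symm, hs⟩
    have hvc := hvcard (i + 1) (by omega) (by omega)
    have hlt : #(Ioc (p i).2 n \ P.image Prod.snd) < i + 1 := by
      rw [← hvc]
      refine card_lt_card (Finset.ssubset_iff_subset_ne.2 ⟨fun y hy => ?_, fun he => ?_⟩)
      · rw [mem_sdiff, mem_Ioc] at hy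
        rw [mem_filter]
        exact ⟨mem_sdiff.2 ⟨mem_Ioc.2 ⟨by omega, hy.1.2⟩, hy.2⟩, by omega⟩
      · have : v (i + 1) ∈ C.filter fun s => v (i + 1) ≤ s :=
          mem_filter.2 ⟨hvmem _ (by omega) (by omega), le_rfl⟩
        rw [← he, mem_sdiff, mem_Ioc] at this
        omega
    omega
  have hbelow' : ∀ i, 1 ≤ i → i ≤ #P → Prec (M, v i) (p i) := by
    intro i h1 h2
    have h3 := hbelow i h1 h2
    have h4 := hvanti i (i + 1) h1 (by omega) (by omega)
    unfold Prec at h3 ⊢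
    simp only at h3 ⊢
    omega
  -- pinnacles occupy the positions `2, 4, …, 2 * #P`
  let idx : ℕ → ℕ := fun j => if 2 * #P < j then j - #P else (j + 1) / 2
  let w : ℕ → ℕ × ℕ := fun j => if j ≤ 2 * #P ∧ j % 2 = 0 then p (j / 2) else (M, v (idx j))
  have hwp : ∀ j, j ≤ 2 * #P ∧ j % 2 = 0 → w j = p (j / 2) := fun j hj => if_pos hj
  have hwv : ∀ j, ¬ (j ≤ 2 * #P ∧ j % 2 = 0) → w j = (M, v (idx j)) := fun j hj => if_neg hj
  have hidx : ∀ j, 1 ≤ j → j ≤ n → 1 ≤ idx j ∧ idx j ≤ #C := by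
    intro j h1 h2
    simp only [idx]
    split_ifs <;> omega
  refine ⟨w, ⟨fun j hj => ?_, fun i hi j hj hij => ?_⟩, ?_⟩
  · rw [mem_Icc] at hj
    by_cases hjp : j ≤ 2 * #P ∧ j % 2 = 0
    · rw [hwp j hjp, mem_Icc]
      have := h.bounds _ (hpmem (j / 2) (by omega) (by omega))
      omega
    · rw [hwv j hjp, mem_Icc]
      obtain ⟨h1, h2⟩ := hidx j hj.1 hj.2
      have := hCmem _ (hvmem _ h1 h2)
      exact ⟨Nat.lt_succ_self M, this.1, this.2.1⟩
  · rw [Set.mem_Icc] at hi hj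
    obtain ⟨hi1, hi2⟩ := hidx i hi.1 hi.2
    obtain ⟨hj1, hj2⟩ := hidx j hj.1 hj.2
    simp only at hij
    by_cases hip : i ≤ 2 * #P ∧ i % 2 = 0 <;> by_cases hjp : j ≤ 2 * #P ∧ j % 2 = 0
    · rw [hwp i hip, hwp j hjp] at hij
      have := hpinj (i / 2) (j / 2) (by omega) (by omega) (by omega) (by omega)
        (h.injOn (hpmem (i / 2) (by omega) (by omega)) (hpmem (j / 2) (by omega) (by omega)) hij)
      omega
    · rw [hwp i hip, hwv j hjp] at hij
      exact absurd hij ((hCmem _ (hvmem _ hj1 hj2)).2.2 _ (hpmem (i / 2) (by omega) (by omega)))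
    · rw [hwv i hip, hwp j hjp] at hij
      exact absurd hij.symm
        ((hCmem _ (hvmem _ hi1 hi2)).2.2 _ (hpmem (j / 2) (by omega) (by omega)))
    · rw [hwv i hip, hwv j hjp] at hij
      have := hvinj _ _ hi1 hi2 hj1 hj2 hij
      simp only [idx] at this
      split_ifs at this <;> omega
  · ext q
    simp only [pin, mem_image, mem_filter, mem_Icc]
    constructor
    · rintro ⟨i, ⟨⟨h1, h2⟩, -, h4⟩, rfl⟩
      by_cases hip : i ≤ 2 * #P ∧ i % 2 = 0
      · rw [hwp i hip]
        exact hpmem _ (by omega) (by omega)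
      · exfalso
        by_cases hi : 2 * #P < i
        · rw [hwv i hip, hwv (i + 1) (by omega)] at h4
          have hi1 : idx i = i - #P := if_pos hi
          have hi2 : idx (i + 1) = i - #P + 1 := by
            simp only [idx]
            rw [if_pos (by omega)]
            omega
          rw [hi1, hi2] at h4
          have := hvanti (i - #P) (i - #P + 1) (by omega) (by omega) (by omega)
          unfold Prec at h4
          simp only at h4
          omega
        · have hi1 : idx i = (i + 1) / 2 := if_neg hi
          rw [hwv i hip, hwp (i + 1) (by omega), hi1] at h4
          have := hbelow' ((i + 1) / 2) (by omega) (by omega)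
          unfold Prec at h4 this
          simp only at h4 this
          omega
    · intro hq
      obtain ⟨i, h1, h2, rfl⟩ := hpsurj q hq
      refine ⟨2 * i, ⟨⟨by omega, by omega⟩, ?_, ?_⟩, ?_⟩
      · rw [hwp (2 * i) (by omega), hwv (2 * i - 1) (by omega), Nat.mul_div_cancel_left i two_pos,
          show idx (2 * i - 1) = i by simp only [idx]; split_ifs <;> omega]
        exact hbelow' i h1 h2
      · rw [hwp (2 * i) (by omega), hwv (2 * i + 1) (by omega), Nat.mul_div_cancel_left i two_pos,
          show idx (2 * i + 1) = i + 1 by simp only [idx]; split_ifs <;> omega]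
        exact hbelow i h1 h2
      · rw [hwp (2 * i) (by omega), Nat.mul_div_cancel_left i two_pos]

theorem ncard_APS (M n d : ℕ) (hd : 2 * d + 1 ≤ n) :
    (APS (M + 1) n d).ncard =
      ∑ k ∈ range (d + 1), M ^ k * n.choose k * (n - k - 1).choose (d - k) := by
  have hset : APS (M + 1) n d =
      ((range (d + 1)).biUnion fun k => (range (d - k + 1)).biUnion fun j =>
        ballotSets M n 0 k j : Finset (Finset (ℕ × ℕ))) := by
    ext P
    simp only [APS, Set.mem_ofPred_eq, mem_coe, mem_biUnion, mem_range, mem_ballotSets]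
    constructor
    · rintro ⟨h, hcard⟩
      have hb := h.isBallotSet
      have := hb.card_eq
      exact ⟨_, by omega, _, by omega, hb, rfl, rfl⟩
    · rintro ⟨k, hk, j, hj, hb, hk', hj'⟩
      have := hb.card_eq
      exact ⟨hb.isAdmissible (by omega), by omega⟩
  have hdisj : ∀ {k j k' j' P}, P ∈ ballotSets M n 0 k j → P ∈ ballotSets M n 0 k' j' →
      k = k' ∧ j = j' := by
    intro k j k' j' P h h'
    rw [mem_ballotSets] at h h'
    omega
  rw [hset, Set.ncard_coe_finset, card_biUnion]
  · refine sum_congr rfl fun k hk => ?_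
    rw [mem_range] at hk
    rw [card_biUnion]
    · have hcount : ∀ j, #(ballotSets M n 0 k j) =
          M ^ k * n.choose k * ballotCount (n - k - 1 + 1) j := by
        intro j
        have := card_ballotSets M n 0 k j
        rwa [zero_add, show n - k = n - k - 1 + 1 by omega] at this
      rw [sum_congr rfl fun j _ => hcount j, ← mul_sum, sum_ballotCount _ _ (by omega)]
    · intro j _ j' _ hjj
      rw [Function.onFun, disjoint_left]
      exact fun P hP hP' => hjj (hdisj hP hP').2
  · intro k _ k' _ hkk
    rw [Function.onFun, disjoint_left]
    intro P hP hP'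
    simp only [mem_biUnion] at hP hP'
    obtain ⟨j, -, hP⟩ := hP
    obtain ⟨j', -, hP'⟩ := hP'
    exact hkk (hdisj hP hP').1

/-- Both closed formulas for the total number `#APS(m,n)` of admissible pinnacle sets. -/
theorem APS_total_card (m n : ℕ) (hm : 1 ≤ m) (hn : 2 ≤ n) :
    ((APS m n ((n - 1) / 2)).ncard : ℤ) =
        (-1) ^ ((n - 1) / 2) *
          ∑ i ∈ Finset.range ((n - 1) / 2 + 1),
            (Nat.choose n i : ℤ) * (m : ℤ) ^ i * (-1) ^ i ∧
      (APS m n ((n - 1) / 2)).ncard =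
        ∑ k ∈ Finset.range ((n - 1) / 2 + 1),
          (m - 1) ^ k * Nat.choose n k * Nat.choose (n - k - 1) ((n - 1) / 2 - k) := by
  obtain ⟨M, rfl⟩ : ∃ M, m = M + 1 := ⟨m - 1, by omega⟩
  have hcard := ncard_APS M n ((n - 1) / 2) (by omega)
  refine ⟨?_, hcard⟩
  have halt := sum_mul_choose_eq_alternating (M : ℤ) n ((n - 1) / 2) (by omega)
  rw [hcard]
  push_cast
  exact halt
end

section
/- For all integers m ≥ 1, n ≥ 2 and 1 ≤ d with 2d + 2 ≤ n (i.e. d ≤ ⌊(n−2)/2⌋), the counting function satisfies #APS_d(m,n) = m · #APS_{d−1}(m, n−1) + #APS_d(m, n−1). Moreover, for 1 ≤ d ≤ ⌊(n−1)/2⌋ the corresponding identity of alternating sums holds: Σ_{i=0}^{d} C(n,i) m^i (−1)^{i+d} = m · Σ_{i=0}^{d−1} C(n−1,i) m^i (−1)^{i+d−1} + Σ_{i=0}^{d} C(n−1,i) m^i (−1)^{i+d}. -/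
open Finset

theorem Prec.trans {p q r : ℕ × ℕ} (h : Prec p q) (h' : Prec q r) : Prec p r := by
  unfold Prec at *; omega

theorem Prec.asymm {p q : ℕ × ℕ} (h : Prec p q) : ¬ Prec q p := by
  unfold Prec at *; omega

theorem Prec.trans_not {p q r : ℕ × ℕ} (h : Prec p q) (h' : ¬ Prec r q) : Prec p r := by
  unfold Prec at *; omega

theorem Prec.recolor {m : ℕ} {p q : ℕ × ℕ} (h : Prec p q) (hp : p.1 < m) :
    Prec (m - 1, p.2) q := by
  unfold Prec at *; dsimp only; omega

theorem prec_iff_toLex {p q : ℕ × ℕ} : Prec p q ↔ toLex q < toLex p := by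
  rw [Prod.Lex.lt_iff]
  simp only [Prec, ofLex_toLex]
  omega

/-- The norms in `{1,…,n}` which are not norms of elements of `P`. -/
def freeNorms (n : ℕ) (P : Finset (ℕ × ℕ)) : Finset ℕ :=
  Icc 1 n \ P.image Prod.snd

/-- `P` consists of symbols of `I_n^m` with pairwise distinct norms. -/
def IsSymbolSet (m n : ℕ) (P : Finset (ℕ × ℕ)) : Prop :=
  (∀ p ∈ P, p.1 < m ∧ p.2 ∈ Icc 1 n) ∧ Set.InjOn Prod.snd (P : Set (ℕ × ℕ))

theorem IsSymbolSet.card_freeNorms {m n : ℕ} {P : Finset (ℕ × ℕ)} (h : IsSymbolSet m n P) :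
    (freeNorms n P).card = n - P.card := by
  rw [freeNorms, card_sdiff_of_subset, card_image_of_injOn h.2, Nat.card_Icc, Nat.add_sub_cancel]
  intro x hx
  obtain ⟨p, hp, rfl⟩ := mem_image.1 hx
  exact (h.1 p hp).2

/-- Every finite set of symbols can be listed increasingly with respect to `Prec`. -/
theorem exists_increasing_enumeration (S : Finset (ℕ × ℕ)) :
    ∃ e : ℕ → ℕ × ℕ, (∀ i < S.card, e i ∈ S) ∧ (∀ x ∈ S, ∃ i < S.card, e i = x) ∧
      ∀ i j, i < j → j < S.card → Prec (e i) (e j) := by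
  classical
  let T : Finset (ℕ ×ₗ ℕ)ᵒᵈ := S.map (toLex.trans OrderDual.toDual).toEmbedding
  have hT : T.card = S.card := card_map _
  let f := T.orderEmbOfFin hT
  refine ⟨fun i => if h : i < S.card then ofLex (OrderDual.ofDual (f ⟨i, h⟩)) else 0, ?_, ?_, ?_⟩
  · intro i hi
    have := T.orderEmbOfFin_mem hT ⟨i, hi⟩
    rw [mem_map] at this
    obtain ⟨x, hx, hxe⟩ := this
    simp only [hi, dite_true, f, ← hxe]
    exact hx
  · intro x hx
    have hx' : OrderDual.toDual (toLex x) ∈ Set.range f := by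
      rw [range_orderEmbOfFin]
      exact mem_coe.2 (mem_map.2 ⟨x, hx, rfl⟩)
    obtain ⟨i, hi⟩ := hx'
    refine ⟨i, i.2, ?_⟩
    simp [hi]
  · intro i j hij hj
    have hi := hij.trans hj
    simp only [hi, hj, dite_true]
    rw [prec_iff_toLex]
    have : f ⟨i, hi⟩ < f ⟨j, hj⟩ := f.strictMono hij
    exact this

theorem prec_of_lt_card_filter {S : Finset (ℕ × ℕ)} {e : ℕ → ℕ × ℕ}
    (hsurj : ∀ x ∈ S, ∃ i < S.card, e i = x)
    (hmono : ∀ i j, i < j → j < S.card → Prec (e i) (e j)) {x : ℕ × ℕ} {i : ℕ}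
    (hi : i < (S.filter fun q => Prec q x).card) : Prec (e i) x := by
  by_contra hx
  have hsub : (S.filter fun q => Prec q x) ⊆ (range i).image e := by
    intro q hq
    obtain ⟨hqS, hqx⟩ := mem_filter.1 hq
    obtain ⟨j, hj, rfl⟩ := hsurj q hqS
    refine mem_image_of_mem _ (mem_range.2 ?_)
    by_contra hji
    rcases (not_lt.1 hji).eq_or_lt with rfl | hlt
    · exact hx hqx
    · exact hx ((hmono i j hlt hj).trans hqx)
  have := (card_le_card hsub).trans card_image_le
  rw [card_range] at this
  omega

/-- Below each pinnacle there are more non-pinnacle norms, recolored minimally,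
than pinnacles weakly below it. -/
theorem card_lt_of_pin {m n : ℕ} {w : ℕ → ℕ × ℕ} (hw : IsGenPerm m n w) {p : ℕ × ℕ}
    (hp : p ∈ pin n w) :
    ((pin n w).filter fun q => ¬ Prec p q).card <
      ((freeNorms n (pin n w)).filter fun y => Prec (m - 1, y) p).card := by
  classical
  set T := (Icc 2 (n - 1)).filter fun i => Prec (w (i - 1)) (w i) ∧ Prec (w (i + 1)) (w i) with hT
  have hpin : pin n w = T.image w := rfl
  set T' := T.filter fun i => ¬ Prec p (w i) with hT'
  have hTmem : ∀ i ∈ T, 2 ≤ i ∧ i ≤ n - 1 ∧ Prec (w (i - 1)) (w i) ∧ Prec (w (i + 1)) (w i) := by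
    intro i hi
    obtain ⟨h1, h2⟩ := mem_filter.1 hi
    exact ⟨(mem_Icc.1 h1).1, (mem_Icc.1 h1).2, h2⟩
  have hne : T'.Nonempty := by
    rw [hpin] at hp
    obtain ⟨i, hi, rfl⟩ := mem_image.1 hp
    exact ⟨i, mem_filter.2 ⟨hi, fun h => h.asymm h⟩⟩
  set a := T'.min' hne with ha
  have haT : a ∈ T' := min'_mem _ _
  have hcard1 : ((pin n w).filter fun q => ¬ Prec p q).card ≤ T'.card := by
    rw [hpin, filter_image]
    exact card_image_le
  set U := insert (a - 1) (T'.image (· + 1)) with hU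
  have hUcard : U.card = T'.card + 1 := by
    rw [hU, card_insert_of_notMem, card_image_of_injective _ (add_left_injective 1)]
    intro h
    obtain ⟨i, hi, hia⟩ := mem_image.1 h
    have := T'.min'_le i hi
    omega
  have hadj : ∀ u ∈ U, ∃ i ∈ T', (u = i - 1 ∨ u = i + 1) := by
    intro u hu
    rcases mem_insert.1 hu with rfl | hu
    · exact ⟨a, haT, Or.inl rfl⟩
    · obtain ⟨i, hi, rfl⟩ := mem_image.1 hu
      exact ⟨i, hi, Or.inr rfl⟩
  have hUprop : ∀ u ∈ U, u ∈ Icc 1 n ∧ Prec (w u) p ∧ u ∉ T := by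
    intro u hu
    obtain ⟨i, hi, hui⟩ := hadj u hu
    obtain ⟨hiT, hip⟩ := mem_filter.1 hi
    obtain ⟨h2, hn, hl, hr⟩ := hTmem i hiT
    have hprec : Prec (w u) (w i) := by rcases hui with rfl | rfl <;> assumption
    refine ⟨mem_Icc.2 (by omega), hprec.trans_not hip, fun huT => ?_⟩
    obtain ⟨h2', -, hl', hr'⟩ := hTmem u huT
    rcases hui with rfl | rfl
    · rw [show i - 1 + 1 = i by omega] at hr'
      exact hprec.asymm hr'
    · exact hprec.asymm hl'
  have hle : U.card ≤ ((freeNorms n (pin n w)).filter fun y => Prec (m - 1, y) p).card := by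
    refine card_le_card_of_injOn (fun u => (w u).2) ?_ ?_
    · intro u hu
      obtain ⟨h1, h2, h3⟩ := hUprop u hu
      refine mem_filter.2 ⟨mem_sdiff.2 ⟨(hw.1 u h1).2, fun h => ?_⟩, h2.recolor (hw.1 u h1).1⟩
      obtain ⟨q, hq, hqu⟩ := mem_image.1 h
      rw [hpin] at hq
      obtain ⟨t, ht, rfl⟩ := mem_image.1 hq
      obtain ⟨ht2, htn, -⟩ := hTmem t ht
      have htu : t = u := hw.2 (Set.mem_Icc.2 (by omega)) (by simpa using h1) hqu
      exact h3 (htu ▸ ht)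
    · intro u hu v hv huv
      exact hw.2 (by simpa using (hUprop u hu).1) (by simpa using (hUprop v hv).1) huv
  omega

theorem isSymbolSet_pin {m n : ℕ} {w : ℕ → ℕ × ℕ} (hw : IsGenPerm m n w) :
    IsSymbolSet m n (pin n w) := by
  have hmem : ∀ p ∈ pin n w, ∃ i ∈ Icc 1 n, w i = p := by
    intro p hp
    obtain ⟨i, hi, rfl⟩ := mem_image.1 hp
    have := mem_Icc.1 (mem_filter.1 hi).1
    exact ⟨i, mem_Icc.2 (by omega), rfl⟩
  constructor
  · intro p hp
    obtain ⟨i, hi, rfl⟩ := hmem p hp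
    exact hw.1 i hi
  · intro p hp q hq hpq
    obtain ⟨i, hi, rfl⟩ := hmem p hp
    obtain ⟨j, hj, rfl⟩ := hmem q hq
    rw [hw.2 (by simpa using hi) (by simpa using hj) hpq]

/-- The word alternating between `v` and `p` up to `p (k - 1)`, then continuing along `v`. -/
def zigzag (k : ℕ) (v p : ℕ → ℕ × ℕ) (i : ℕ) : ℕ × ℕ :=
  if 2 * k < i then v (i - 1 - k) else if i % 2 = 0 then p (i / 2 - 1) else v (i / 2)

theorem zigzag_even {k j : ℕ} (v p : ℕ → ℕ × ℕ) (h : j < k) :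
    zigzag k v p (2 * j + 2) = p j := by
  rw [zigzag, if_neg (by omega), if_pos (by omega)]
  congr 1; omega

theorem zigzag_odd {k j : ℕ} (v p : ℕ → ℕ × ℕ) (h : j ≤ k) :
    zigzag k v p (2 * j + 1) = v j := by
  rw [zigzag]
  split_ifs
  · congr 1; omega
  · omega
  · congr 1; omega

theorem zigzag_tail {k j : ℕ} (v p : ℕ → ℕ × ℕ) (h : k ≤ j) :
    zigzag k v p (j + k + 1) = v j := by
  rw [zigzag, if_pos (by omega)]
  congr 1; omega

theorem zigzag_cases (k i : ℕ) (hi : 1 ≤ i) :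
    (∃ j < k, i = 2 * j + 2) ∨ (∃ j < k, i = 2 * j + 1) ∨ ∃ j ≥ k, i = j + k + 1 := by
  rcases lt_or_ge (2 * k) i with h | h
  · exact Or.inr (Or.inr ⟨i - 1 - k, by omega, by omega⟩)
  · rcases Nat.even_or_odd' i with ⟨j, rfl | rfl⟩
    · exact Or.inl ⟨j - 1, by omega, by omega⟩
    · exact Or.inr (Or.inl ⟨j, by omega, rfl⟩)

theorem pin_zigzag {k n : ℕ} {v p : ℕ → ℕ × ℕ} (hkn : 2 * k + 1 ≤ n)
    (hv : ∀ i j, i < j → j < n - k → Prec (v i) (v j))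
    (hvp : ∀ i < k, Prec (v i) (p i) ∧ Prec (v (i + 1)) (p i)) :
    pin n (zigzag k v p) = (range k).image p := by
  ext x
  simp only [pin, mem_image, mem_filter, mem_Icc, mem_range]
  constructor
  · rintro ⟨i, ⟨⟨hi2, hin⟩, -, hr⟩, rfl⟩
    rcases zigzag_cases k i (by omega) with ⟨j, hj, rfl⟩ | ⟨j, hj, rfl⟩ | ⟨j, hj, rfl⟩
    · exact ⟨j, hj, (zigzag_even v p hj).symm⟩
    · rw [zigzag_odd v p hj.le, zigzag_even v p hj] at hr
      exact absurd hr (hvp j hj).1.asymm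
    · rw [zigzag_tail v p hj, show j + k + 1 + 1 = (j + 1) + k + 1 by ring,
        zigzag_tail v p (by omega)] at hr
      exact absurd hr (hv j (j + 1) (by omega) (by omega)).asymm
  · rintro ⟨j, hj, rfl⟩
    refine ⟨2 * j + 2, ⟨⟨by omega, by omega⟩, ?_⟩, zigzag_even v p hj⟩
    rw [show 2 * j + 2 - 1 = 2 * j + 1 by omega, show 2 * j + 2 + 1 = 2 * (j + 1) + 1 by ring,
      zigzag_even v p hj, zigzag_odd v p hj.le, zigzag_odd v p hj]
    exact hvp j hj

theorem isAdmissible_of_card_lt {m n : ℕ} {P : Finset (ℕ × ℕ)} (hm : 1 ≤ m)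
    (hP : IsSymbolSet m n P) (hcard : 2 * P.card + 1 ≤ n)
    (h : ∀ p ∈ P, (P.filter fun q => ¬ Prec p q).card <
      ((freeNorms n P).filter fun y => Prec (m - 1, y) p).card) :
    IsAdmissible m n P := by
  classical
  have hinj : Function.Injective fun y : ℕ => (m - 1, y) := fun a b hab => (Prod.ext_iff.1 hab).2
  set V := (freeNorms n P).image fun y => (m - 1, y) with hV
  have hVcard : V.card = n - P.card := by
    rw [hV, card_image_of_injective _ hinj, hP.card_freeNorms]
  obtain ⟨p, hpmem, hpsurj, hpmono⟩ := exists_increasing_enumeration P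
  obtain ⟨v, hvmem, hvsurj, hvmono⟩ := exists_increasing_enumeration V
  have hvV : ∀ j < n - P.card, (v j).1 = m - 1 ∧ (v j).2 ∈ freeNorms n P := by
    intro j hj
    obtain ⟨y, hy, hyv⟩ := mem_image.1 (hvmem j (hVcard ▸ hj))
    rw [← hyv]
    exact ⟨rfl, hy⟩
  have hvp : ∀ i < P.card, Prec (v i) (p i) ∧ Prec (v (i + 1)) (p i) := by
    intro i hi
    have h1 := h (p i) (hpmem i hi)
    have h2 : (V.filter fun q => Prec q (p i)).card =
        ((freeNorms n P).filter fun y => Prec (m - 1, y) (p i)).card := by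
      rw [hV, filter_image, card_image_of_injective _ hinj]
    have h3 : i + 1 ≤ (P.filter fun q => ¬ Prec (p i) q).card := by
      rw [← card_range (i + 1)]
      refine card_le_card_of_injOn p ?_ ?_
      · intro j hj
        have hj := mem_range.1 hj
        refine mem_filter.2 ⟨hpmem j (by omega), ?_⟩
        rcases (Nat.lt_succ_iff.1 hj).eq_or_lt with rfl | hlt
        · exact fun h => h.asymm h
        · exact (hpmono j i hlt hi).asymm
      · intro a ha b hb hab
        have ha := mem_range.1 ha
        have hb := mem_range.1 hb
        by_contra hne
        rcases Nat.lt_or_gt_of_ne hne with hlt | hlt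
        · have := hpmono a b hlt (by omega)
          rw [hab] at this
          exact this.asymm this
        · have := hpmono b a hlt (by omega)
          rw [hab] at this
          exact this.asymm this
    exact ⟨prec_of_lt_card_filter hvsurj hvmono (by omega),
      prec_of_lt_card_filter hvsurj hvmono (by omega)⟩
  have hrange : ∀ i ∈ Icc 1 n,
      (zigzag P.card v p i).1 < m ∧ (zigzag P.card v p i).2 ∈ Icc 1 n := by
    intro i hi
    obtain ⟨hi1, hin⟩ := mem_Icc.1 hi
    have hv' : ∀ j < n - P.card, (v j).1 < m ∧ (v j).2 ∈ Icc 1 n := fun j hj =>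
      ⟨by have := (hvV j hj).1; omega, (mem_sdiff.1 (hvV j hj).2).1⟩
    rcases zigzag_cases P.card i hi1 with ⟨j, hj, rfl⟩ | ⟨j, hj, rfl⟩ | ⟨j, hj, rfl⟩
    · rw [zigzag_even v p hj]
      exact hP.1 _ (hpmem j hj)
    · rw [zigzag_odd v p hj.le]
      exact hv' j (by omega)
    · rw [zigzag_tail v p hj]
      exact hv' j (by omega)
  refine ⟨zigzag P.card v p, ⟨hrange, ?_⟩, ?_⟩
  · have hsurj : Set.SurjOn (fun i => (zigzag P.card v p i).2) (Icc 1 n : Finset ℕ)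
        (Icc 1 n : Finset ℕ) := by
      intro y hy
      by_cases hyP : y ∈ P.image Prod.snd
      · obtain ⟨q, hq, rfl⟩ := mem_image.1 hyP
        obtain ⟨j, hj, rfl⟩ := hpsurj q hq
        refine ⟨2 * j + 2, mem_coe.2 (mem_Icc.2 (by omega)), ?_⟩
        simp only [zigzag_even v p hj]
      · have hyV : (m - 1, y) ∈ V := mem_image_of_mem _ (mem_sdiff.2 ⟨hy, hyP⟩)
        obtain ⟨j, hj, hjy⟩ := hvsurj _ hyV
        rw [hVcard] at hj
        rcases lt_or_ge j P.card with hjk | hjk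
        · refine ⟨2 * j + 1, mem_coe.2 (mem_Icc.2 (by omega)), ?_⟩
          simp only [zigzag_odd v p hjk.le, hjy]
        · refine ⟨j + P.card + 1, mem_coe.2 (mem_Icc.2 (by omega)), ?_⟩
          simp only [zigzag_tail v p hjk, hjy]
    have := injOn_of_surjOn_of_card_le _ (fun i hi => (hrange i hi).2) hsurj le_rfl
    simpa using this
  · rw [pin_zigzag hcard (hVcard ▸ hvmono) hvp]
    ext x
    simp only [mem_image, mem_range]
    exact ⟨fun ⟨i, hi, hx⟩ => hx ▸ hpmem i hi, hpsurj x⟩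

/-- The ballot condition: reading norms downwards from `n`, at each symbol of `P` of the
largest color the free norms outnumber the symbols of that color. -/
def IsBallot (m n : ℕ) (P : Finset (ℕ × ℕ)) : Prop :=
  ∀ p ∈ P, p.1 + 1 = m → (P.filter fun q => q.1 + 1 = m ∧ p.2 ≤ q.2).card <
    (Ioc p.2 n \ P.image Prod.snd).card

theorem isAdmissible_iff {m n : ℕ} {P : Finset (ℕ × ℕ)} (hm : 1 ≤ m)
    (hcard : 2 * P.card + 1 ≤ n) :
    IsAdmissible m n P ↔ IsSymbolSet m n P ∧ IsBallot m n P := by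
  have key : IsSymbolSet m n P → ∀ p ∈ P, p.1 + 1 = m →
      (P.filter fun q => ¬ Prec p q) = (P.filter fun q => q.1 + 1 = m ∧ p.2 ≤ q.2) ∧
      ((freeNorms n P).filter fun y => Prec (m - 1, y) p) = Ioc p.2 n \ P.image Prod.snd := by
    intro hP p hp hpm
    constructor
    · refine filter_congr fun q hq => ?_
      have := (hP.1 q hq).1
      unfold Prec; omega
    · ext y
      have hy : Prec (m - 1, y) p ↔ p.2 < y := by unfold Prec; dsimp only; omega
      simp only [freeNorms, mem_filter, mem_sdiff, mem_Icc, mem_Ioc, hy]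
      constructor
      · rintro ⟨⟨h1, h2⟩, h3⟩
        exact ⟨⟨h3, h1.2⟩, h2⟩
      · rintro ⟨h1, h2⟩
        exact ⟨⟨⟨by omega, h1.2⟩, h2⟩, h1.1⟩
  constructor
  · rintro ⟨w, hw, rfl⟩
    have hP := isSymbolSet_pin hw
    refine ⟨hP, fun p hp hpm => ?_⟩
    rw [← (key hP p hp hpm).1, ← (key hP p hp hpm).2]
    exact card_lt_of_pin hw hp
  · rintro ⟨hP, hB⟩
    refine isAdmissible_of_card_lt hm hP hcard fun p hp => ?_
    by_cases hpm : p.1 + 1 = m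
    · rw [(key hP p hp hpm).1, (key hP p hp hpm).2]
      exact hB p hp hpm
    · have hlt := (hP.1 p hp).1
      have hall : ((freeNorms n P).filter fun y => Prec (m - 1, y) p) = freeNorms n P := by
        refine filter_true_of_mem fun y _ => Or.inl ?_
        dsimp only; omega
      rw [hall, hP.card_freeNorms]
      have := card_filter_le P fun q => ¬ Prec p q
      omega

/-- Raising the norm of a symbol by one. -/
def raise : ℕ × ℕ ↪ ℕ × ℕ where
  toFun p := (p.1, p.2 + 1)
  inj' p q h := by
    simp only [Prod.mk.injEq, add_left_inj] at h
    exact Prod.ext h.1 h.2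

@[simp]
theorem raise_apply (p : ℕ × ℕ) : raise p = (p.1, p.2 + 1) := rfl

theorem notMem_map_raise {m n : ℕ} {Q : Finset (ℕ × ℕ)} (hQ : IsSymbolSet m n Q) (c : ℕ) :
    (c, 1) ∉ Q.map raise := by
  intro h
  obtain ⟨q, hq, hqc⟩ := mem_map.1 h
  have := mem_Icc.1 (hQ.1 q hq).2
  simp only [raise_apply, Prod.mk.injEq] at hqc
  omega

theorem isSymbolSet_map_raise {m n : ℕ} {Q : Finset (ℕ × ℕ)} (hQ : IsSymbolSet m n Q) :
    IsSymbolSet m (n + 1) (Q.map raise) := by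
  constructor
  · intro p hp
    obtain ⟨q, hq, rfl⟩ := mem_map.1 hp
    have := hQ.1 q hq
    simp only [mem_Icc, raise_apply] at this ⊢
    omega
  · intro p hp q hq hpq
    obtain ⟨p, hpQ, rfl⟩ := mem_map.1 hp
    obtain ⟨q, hqQ, rfl⟩ := mem_map.1 hq
    rw [hQ.2 hpQ hqQ (by simpa using hpq)]

theorem isSymbolSet_insert_map_raise {m n c : ℕ} {Q : Finset (ℕ × ℕ)} (hc : c < m)
    (hQ : IsSymbolSet m n Q) : IsSymbolSet m (n + 1) (insert (c, 1) (Q.map raise)) := by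
  have hQ' := isSymbolSet_map_raise hQ
  constructor
  · intro p hp
    rcases mem_insert.1 hp with rfl | hp
    · exact ⟨hc, mem_Icc.2 (by dsimp only; omega)⟩
    · exact hQ'.1 p hp
  · rw [coe_insert, Set.injOn_insert (by simpa using notMem_map_raise hQ c)]
    refine ⟨hQ'.2, ?_⟩
    rintro ⟨⟨a, x⟩, hq, rfl : x = 1⟩
    exact notMem_map_raise hQ a hq

/-- A set of symbols splits into its part of norm one and a raised set. -/
theorem exists_map_raise {m n : ℕ} {P : Finset (ℕ × ℕ)} (hP : IsSymbolSet m (n + 1) P) :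
    ∃ Q, IsSymbolSet m n Q ∧ (P = Q.map raise ∨ ∃ c < m, P = insert (c, 1) (Q.map raise)) := by
  classical
  set Q := (P.filter fun p => p.2 ≠ 1).image fun p => (p.1, p.2 - 1) with hQdef
  have hmem : ∀ q, q ∈ Q ↔ raise q ∈ P ∧ 1 ≤ q.2 := by
    intro q
    simp only [hQdef, mem_image, mem_filter, raise_apply]
    constructor
    · rintro ⟨p, ⟨hp, hp1⟩, rfl⟩
      have := mem_Icc.1 (hP.1 p hp).2
      dsimp only
      rw [show p.2 - 1 + 1 = p.2 by omega]
      exact ⟨hp, by omega⟩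
    · rintro ⟨hq, hq1⟩
      exact ⟨_, ⟨hq, by dsimp only; omega⟩, rfl⟩
  have hsplit : ∀ p ∈ P, p.2 ≠ 1 → p ∈ Q.map raise := by
    intro p hp hp1
    have := mem_Icc.1 (hP.1 p hp).2
    have hpr : raise (p.1, p.2 - 1) = p := Prod.ext rfl (by simp only [raise_apply]; omega)
    exact mem_map.2 ⟨(p.1, p.2 - 1), (hmem _).2 ⟨hpr ▸ hp, by dsimp only; omega⟩, hpr⟩
  have hsub : Q.map raise ⊆ P := by
    intro p hp
    obtain ⟨q, hq, rfl⟩ := mem_map.1 hp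
    exact ((hmem q).1 hq).1
  refine ⟨Q, ⟨?_, ?_⟩, ?_⟩
  · intro q hq
    obtain ⟨h1, h2⟩ := (hmem q).1 hq
    have := hP.1 _ h1
    simp only [mem_Icc, raise_apply] at this ⊢
    omega
  · intro p hp q hq hpq
    exact raise.injective (hP.2 ((hmem p).1 hp).1 ((hmem q).1 hq).1 (by simpa using hpq))
  · by_cases h1 : ∃ p ∈ P, p.2 = 1
    · obtain ⟨p, hp, hp1⟩ := h1
      refine Or.inr ⟨p.1, (hP.1 p hp).1, ?_⟩
      have hpe : (p.1, 1) = p := Prod.ext rfl hp1.symm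
      rw [hpe]
      refine Subset.antisymm (fun q hq => mem_insert.2 ?_) (insert_subset hp hsub)
      by_cases hq1 : q.2 = 1
      · exact Or.inl (hP.2 hq hp (hq1.trans hp1.symm))
      · exact Or.inr (hsplit q hq hq1)
    · refine Or.inl (Subset.antisymm (fun q hq => hsplit q hq fun hq1 => h1 ⟨q, hq, hq1⟩) hsub)

theorem card_filter_map_raise (m x : ℕ) (Q : Finset (ℕ × ℕ)) :
    ((Q.map raise).filter fun q => q.1 + 1 = m ∧ x + 1 ≤ q.2).card =
      (Q.filter fun q => q.1 + 1 = m ∧ x ≤ q.2).card := by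
  rw [filter_map, card_map]
  congr 1
  refine filter_congr fun q _ => ?_
  simp

theorem card_Ioc_sdiff_map_raise (n x : ℕ) (Q : Finset (ℕ × ℕ)) :
    (Ioc (x + 1) (n + 1) \ (Q.map raise).image Prod.snd).card =
      (Ioc x n \ Q.image Prod.snd).card := by
  rw [← card_map (addRightEmbedding 1) (s := Ioc x n \ Q.image Prod.snd)]
  congr 1
  ext y
  cases y with
  | zero => simp
  | succ y => simp

theorem isBallot_map_raise {m n : ℕ} {Q : Finset (ℕ × ℕ)} :
    IsBallot m (n + 1) (Q.map raise) ↔ IsBallot m n Q := by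
  rw [IsBallot, forall_mem_map]
  refine forall₂_congr fun p _ => ?_
  rw [raise_apply, card_filter_map_raise, card_Ioc_sdiff_map_raise]

theorem isBallot_insert_map_raise {m n c : ℕ} {Q : Finset (ℕ × ℕ)} (hQ : IsSymbolSet m n Q)
    (hcard : 2 * Q.card + 1 < n) :
    IsBallot m (n + 1) (insert (c, 1) (Q.map raise)) ↔ IsBallot m n Q := by
  rw [← isBallot_map_raise (Q := Q)]
  have hnorm : ∀ p ∈ Q.map raise, 1 < p.2 := by
    intro p hp
    obtain ⟨q, hq, rfl⟩ := mem_map.1 hp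
    have := mem_Icc.1 (hQ.1 q hq).2
    simp only [raise_apply]
    omega
  have hfilter : ∀ x, 1 < x →
      ((insert (c, 1) (Q.map raise)).filter fun q => q.1 + 1 = m ∧ x ≤ q.2) =
        (Q.map raise).filter fun q => q.1 + 1 = m ∧ x ≤ q.2 := by
    intro x hx
    rw [filter_insert, if_neg (by dsimp only; omega)]
  have hfree : ∀ x, 1 ≤ x → Ioc x (n + 1) \ (insert (c, 1) (Q.map raise)).image Prod.snd =
      Ioc x (n + 1) \ (Q.map raise).image Prod.snd := by
    intro x hx
    ext y
    simp only [image_insert, mem_sdiff, mem_Ioc, mem_insert]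
    constructor
    · rintro ⟨h1, h2⟩
      exact ⟨h1, fun h => h2 (Or.inr h)⟩
    · rintro ⟨h1, h2⟩
      exact ⟨h1, fun h => h.elim (fun h => by omega) h2⟩
  constructor
  · intro h p hp hpm
    have := h p (mem_insert_of_mem hp) hpm
    rwa [hfilter _ (hnorm p hp), hfree _ (hnorm p hp).le] at this
  · intro h p hp hpm
    rcases mem_insert.1 hp with rfl | hp
    · rw [hfree _ le_rfl]
      have h1 := (card_filter_le (insert (c, 1) (Q.map raise))
        fun q => q.1 + 1 = m ∧ 1 ≤ q.2).trans (card_insert_le _ _)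
      have h2 := le_card_sdiff ((Q.map raise).image Prod.snd) (Ioc 1 (n + 1))
      have h3 : ((Q.map raise).image Prod.snd).card ≤ (Q.map raise).card := card_image_le
      rw [card_map] at h1 h3
      rw [Nat.card_Ioc] at h2
      dsimp only at h1 h2 ⊢
      omega
    · rw [hfilter _ (hnorm p hp), hfree _ (hnorm p hp).le]
      exact h p hp hpm

theorem mem_APS_iff {m n d : ℕ} (hm : 1 ≤ m) (hd : 2 * d + 1 ≤ n) {P : Finset (ℕ × ℕ)} :
    P ∈ APS m n d ↔ (IsSymbolSet m n P ∧ IsBallot m n P) ∧ P.card ≤ d :=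
  and_congr_left fun h => isAdmissible_iff hm (by omega)

theorem finite_APS (m n d : ℕ) : (APS m n d).Finite := by
  refine (finite_toSet (range m ×ˢ Icc 1 n).powerset).subset ?_
  rintro P ⟨⟨w, hw, rfl⟩, -⟩
  refine mem_coe.2 (mem_powerset.2 fun p hp => mem_product.2 ?_)
  obtain ⟨h1, h2⟩ := (isSymbolSet_pin hw).1 p hp
  exact ⟨mem_range.2 h1, h2⟩

theorem APS_succ_eq {m n d : ℕ} (hm : 1 ≤ m) (hd : 2 * d + 3 ≤ n) :
    APS m (n + 1) (d + 1) = (fun Q => Q.map raise) '' APS m n (d + 1) ∪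
      (fun x : ℕ × Finset (ℕ × ℕ) => insert (x.1, 1) (x.2.map raise)) ''
        (Set.Iio m ×ˢ APS m n d) := by
  ext P
  rw [Set.mem_union, Set.mem_image, Set.mem_image, mem_APS_iff hm (by omega)]
  constructor
  · rintro ⟨⟨hP, hB⟩, hcard⟩
    obtain ⟨Q, hQ, rfl | ⟨c, hc, rfl⟩⟩ := exists_map_raise hP
    · rw [card_map] at hcard
      exact Or.inl ⟨Q, (mem_APS_iff hm (by omega)).2 ⟨⟨hQ, isBallot_map_raise.1 hB⟩, hcard⟩, rfl⟩
    · rw [card_insert_of_notMem (notMem_map_raise hQ c), card_map] at hcard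
      exact Or.inr ⟨(c, Q), ⟨hc, (mem_APS_iff hm (by omega)).2
        ⟨⟨hQ, (isBallot_insert_map_raise hQ (by omega)).1 hB⟩,
          Nat.le_of_succ_le_succ hcard⟩⟩, rfl⟩
  · rintro (⟨Q, hQ, rfl⟩ | ⟨⟨c, Q⟩, ⟨hc, hQ⟩, rfl⟩)
    · obtain ⟨⟨hQ, hB⟩, hcard⟩ := (mem_APS_iff hm (by omega)).1 hQ
      exact ⟨⟨isSymbolSet_map_raise hQ, isBallot_map_raise.2 hB⟩, by simpa using hcard⟩
    · replace hQ : Q ∈ APS m n d := hQ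
      obtain ⟨⟨hQ, hB⟩, hcard⟩ := (mem_APS_iff hm (by omega)).1 hQ
      refine ⟨⟨isSymbolSet_insert_map_raise hc hQ,
        (isBallot_insert_map_raise hQ (by omega)).2 hB⟩, ?_⟩
      rw [card_insert_of_notMem (notMem_map_raise hQ c), card_map]
      omega

theorem ncard_APS_succ {m n d : ℕ} (hm : 1 ≤ m) (hd : 2 * d + 3 ≤ n) :
    (APS m (n + 1) (d + 1)).ncard = m * (APS m n d).ncard + (APS m n (d + 1)).ncard := by
  have hsymb : ∀ {e Q}, Q ∈ APS m n e → IsSymbolSet m n Q := by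
    rintro e _ ⟨⟨w, hw, rfl⟩, -⟩
    exact isSymbolSet_pin hw
  have hinj : Set.InjOn (fun x : ℕ × Finset (ℕ × ℕ) => insert (x.1, 1) (x.2.map raise))
      (Set.Iio m ×ˢ APS m n d) := by
    rintro ⟨c, Q⟩ ⟨-, hQ⟩ ⟨c', Q'⟩ ⟨-, hQ'⟩ heq
    dsimp only at hQ hQ' heq
    have hc : (c, 1) ∈ insert (c', 1) (Q'.map raise) := heq ▸ mem_insert_self _ _
    have hcc : (c, 1) = (c', 1) :=
      (mem_insert.1 hc).resolve_right (notMem_map_raise (hsymb hQ') c)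
    obtain rfl : c = c' := congrArg Prod.fst hcc
    have := congrArg (fun S => S.erase (c, 1)) heq
    rw [erase_insert (notMem_map_raise (hsymb hQ) c),
      erase_insert (notMem_map_raise (hsymb hQ') c)] at this
    rw [map_injective raise this]
  have hdisj : Disjoint ((fun Q => Q.map raise) '' APS m n (d + 1))
      ((fun x : ℕ × Finset (ℕ × ℕ) => insert (x.1, 1) (x.2.map raise)) ''
        (Set.Iio m ×ˢ APS m n d)) := by
    rw [Set.disjoint_left]
    rintro _ ⟨Q, hQ, rfl⟩ ⟨⟨c, Q'⟩, -, heq⟩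
    dsimp only at heq
    exact notMem_map_raise (hsymb hQ) c (heq ▸ mem_insert_self _ _)
  rw [APS_succ_eq hm hd, Set.ncard_union_eq hdisj ((finite_APS _ _ _).image _)
      (((Set.finite_Iio m).prod (finite_APS _ _ _)).image _),
    Set.ncard_image_of_injective _ (map_injective raise), hinj.ncard_image, Set.ncard_prod,
    add_comm]
  simp

theorem alternating_sum_succ (m : ℤ) (n d : ℕ) :
    (∑ i ∈ range (d + 2), (Nat.choose (n + 1) i : ℤ) * m ^ i * (-1) ^ (i + (d + 1))) =
      m * (∑ i ∈ range (d + 1), (Nat.choose n i : ℤ) * m ^ i * (-1) ^ (i + d)) +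
        ∑ i ∈ range (d + 2), (Nat.choose n i : ℤ) * m ^ i * (-1) ^ (i + (d + 1)) := by
  rw [sum_range_succ', sum_range_succ' _ (d + 1), mul_sum,
    ← add_assoc (∑ i ∈ _, _), ← sum_add_distrib]
  congr 1
  · refine sum_congr rfl fun i _ => ?_
    rw [Nat.choose_succ_succ]
    push_cast
    ring
  · simp

/-- The recursion `#APS_d(m,n) = m·#APS_{d-1}(m,n-1) + #APS_d(m,n-1)`, together with
the corresponding identity of alternating sums. -/
theorem APS_card_recursion_n (m n d : ℕ) (hm : 1 ≤ m) (hn : 2 ≤ n)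
    (hd1 : 1 ≤ d) (hd2 : 2 * d + 2 ≤ n) :
    (APS m n d).ncard =
        m * (APS m (n - 1) (d - 1)).ncard + (APS m (n - 1) d).ncard ∧
      ∀ d' : ℕ, 1 ≤ d' → d' ≤ (n - 1) / 2 →
        (∑ i ∈ Finset.range (d' + 1),
            (Nat.choose n i : ℤ) * (m : ℤ) ^ i * (-1) ^ (i + d')) =
          (m : ℤ) *
              (∑ i ∈ Finset.range d',
                (Nat.choose (n - 1) i : ℤ) * (m : ℤ) ^ i * (-1) ^ (i + (d' - 1))) +
            ∑ i ∈ Finset.range (d' + 1),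
              (Nat.choose (n - 1) i : ℤ) * (m : ℤ) ^ i * (-1) ^ (i + d') := by
  obtain ⟨n, rfl⟩ : ∃ k, n = k + 1 := ⟨n - 1, by omega⟩
  obtain ⟨d, rfl⟩ : ∃ k, d = k + 1 := ⟨d - 1, by omega⟩
  refine ⟨ncard_APS_succ hm (by omega), fun d' hd' _ => ?_⟩
  obtain ⟨d', rfl⟩ : ∃ k, d' = k + 1 := ⟨d' - 1, by omega⟩
  exact alternating_sum_succ m n d'
end
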